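/- arXiv:1006.3416 — 2 statements merged into one kernel-verified Lean document; each statement's English description precedes it below -/
import Mathlib

section
/- Let A be a unital C*-algebra, let p, q > 0, and let (R, S) be a (p², q²)-commuting pair of normal elements of A, i.e. z(R)·z(S*) = z_{pq}(S*)·z_{q/p}(R) and z_{q/p}(R)·z(S) = z_{pq}(S)·z(R). Then R·S = p²·S·R and R·S* = q²·S*·R. -/
/-- The scaled `z`-transform `z_t(a) = t • a * (1 + t² a* a)^{-1/2}` of an element of a unital
C⋆-algebra, the inverse square root being given by continuous functional calculus. -/
noncomputable def zTransform {A : Type*} [CStarAlgebra A] (t : ℝ) (a : A) : A :=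
  t • (a * cfc (fun x : ℝ => (Real.sqrt (1 + t ^ 2 * x))⁻¹) (star a * a))

theorem SemiconjBy.of_star_left {A : Type*} [Mul A] [StarMul A] {x a b : A}
    (h : SemiconjBy (star x) a b) (ha : IsSelfAdjoint a) (hb : IsSelfAdjoint b) :
    SemiconjBy x b a := by
  have := congrArg star h.eq
  rw [star_mul, star_mul, star_star, ha.star_eq, hb.star_eq] at this
  exact this.symm

/-- If `x` intertwines the self-adjoint elements `a` and `b`, then it intertwines `cfc f a` and
`cfc f b`. -/
theorem SemiconjBy.cfc_real {A : Type*} [CStarAlgebra A] {x a b : A} (h : SemiconjBy x a b)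
    (ha : IsSelfAdjoint a) (hb : IsSelfAdjoint b) (f : ℝ → ℝ)
    (hf : ContinuousOn f (spectrum ℝ a ∪ spectrum ℝ b)) :
    SemiconjBy x (cfc f a) (cfc f b) := by
  have ha' : spectrum ℝ a ⊆ spectrum ℝ a ∪ spectrum ℝ b := Set.subset_union_left
  have hb' : spectrum ℝ b ⊆ spectrum ℝ a ∪ spectrum ℝ b := Set.subset_union_right
  have : CompactSpace ↑(spectrum ℝ a ∪ spectrum ℝ b) := isCompact_iff_compactSpace.mp <|
    (ContinuousFunctionalCalculus.isCompact_spectrum (R := ℝ) a).union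
      (ContinuousFunctionalCalculus.isCompact_spectrum (R := ℝ) b)
  have key (g : C(↑(spectrum ℝ a ∪ spectrum ℝ b), ℝ)) :
      SemiconjBy x (cfcHomSuperset ha ha' g) (cfcHomSuperset hb hb' g) := by
    induction g using ContinuousMap.induction_on_of_compact with
    | const r =>
      have h1 : cfcHomSuperset ha ha' (.const _ r) = algebraMap ℝ A r :=
        AlgHomClass.commutes (cfcHomSuperset ha ha') r
      have h2 : cfcHomSuperset hb hb' (.const _ r) = algebraMap ℝ A r :=
        AlgHomClass.commutes (cfcHomSuperset hb hb') r
      rw [h1, h2]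
      exact Algebra.commute_algebraMap_right r x
    | id => rwa [cfcHomSuperset_id, cfcHomSuperset_id]
    | star_id =>
      rwa [map_star, map_star, cfcHomSuperset_id, cfcHomSuperset_id, ha.star_eq, hb.star_eq]
    | add f g hf hg => rw [map_add, map_add]; exact hf.add_right hg
    | mul f g hf hg => rw [map_mul, map_mul]; exact hf.mul_right hg
    | frequently f hf =>
      have hcl : IsClosed {g | SemiconjBy x (cfcHomSuperset ha ha' g)
          (cfcHomSuperset hb hb' g)} :=
        isClosed_eq (continuous_const.mul (cfcHomSuperset_continuous ha ha'))
          ((cfcHomSuperset_continuous hb hb').mul continuous_const)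
      exact hcl.closure_eq.subset (mem_closure_iff_frequently.mpr hf)
  have := key ⟨_, hf.domRestrict⟩
  rw [cfcHomSuperset_apply, cfcHomSuperset_apply] at this
  rw [cfc_apply f a ha (hf.mono ha'), cfc_apply f b hb (hf.mono hb')]
  exact this

/-- The inverse square root `(1 + a)^{-1/2}` of a nonnegative element `a`. -/
noncomputable def invSqrtOneAdd {A : Type*} [CStarAlgebra A] (a : A) : A :=
  cfc (fun x : ℝ => (Real.sqrt (1 + x))⁻¹) a

section

variable {A : Type*} [CStarAlgebra A]

theorem continuousOn_inv_sqrt_one_add :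
    ContinuousOn (fun x : ℝ => (Real.sqrt (1 + x))⁻¹) (Set.Ici 0) := by
  refine ContinuousOn.inv₀ (by fun_prop) fun x hx => ?_
  have : (0 : ℝ) ≤ x := hx
  positivity

theorem spectrum_smul_star_mul_self_subset (t : ℝ) (a : A) :
    spectrum ℝ (t ^ 2 • (star a * a)) ⊆ Set.Ici 0 := by
  have h : t ^ 2 • (star a * a) = star (t • a) * (t • a) := by
    simp [smul_smul, sq]
  rw [h]
  intro x hx
  exact spectrum_star_mul_self_nonneg x hx

theorem isSelfAdjoint_smul_star_mul_self (t : ℝ) (a : A) :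
    IsSelfAdjoint (t ^ 2 • (star a * a)) :=
  (IsSelfAdjoint.all (t ^ 2)).smul (IsSelfAdjoint.star_mul_self a)

theorem isSelfAdjoint_invSqrtOneAdd (a : A) : IsSelfAdjoint (invSqrtOneAdd a) :=
  cfc_predicate _ _

theorem SemiconjBy.invSqrtOneAdd {x a b : A} (h : SemiconjBy x a b)
    (ha : IsSelfAdjoint a) (hb : IsSelfAdjoint b)
    (ha' : spectrum ℝ a ⊆ Set.Ici 0) (hb' : spectrum ℝ b ⊆ Set.Ici 0) :
    SemiconjBy x (invSqrtOneAdd a) (invSqrtOneAdd b) :=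
  h.cfc_real ha hb _ (continuousOn_inv_sqrt_one_add.mono (Set.union_subset ha' hb'))

theorem commute_invSqrtOneAdd {x a : A} (h : Commute x a) : Commute x (invSqrtOneAdd a) :=
  (h.symm.cfc_real _).symm

theorem invSqrtOneAdd_mul_self_mul {a : A} (ha : IsSelfAdjoint a)
    (ha' : spectrum ℝ a ⊆ Set.Ici 0) :
    invSqrtOneAdd a * invSqrtOneAdd a * (1 + a) = 1 := by
  have hc := continuousOn_inv_sqrt_one_add.mono ha'
  have h1 : (1 + a : A) = cfc (fun x : ℝ => 1 + x) a := by
    rw [cfc_const_add (1 : ℝ) (fun x : ℝ => x) a, cfc_id' ℝ a]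
    simp
  rw [invSqrtOneAdd, h1, ← cfc_mul _ _ a hc hc, ← cfc_mul (fun x : ℝ => (Real.sqrt (1 + x))⁻¹ * (Real.sqrt (1 + x))⁻¹) _ a (hc.mul hc)
      (by fun_prop)]
  rw [← cfc_one ℝ a]
  refine cfc_congr fun x hx => ?_
  have hx0 : (0 : ℝ) ≤ x := ha' hx
  have : Real.sqrt (1 + x) ≠ 0 := by positivity
  have h2 : Real.sqrt (1 + x) * Real.sqrt (1 + x) = 1 + x := Real.mul_self_sqrt (by positivity)
  simp only [Pi.one_apply]
  field_simp
  rw [sq, h2]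

theorem isUnit_invSqrtOneAdd {a : A} (ha : IsSelfAdjoint a)
    (ha' : spectrum ℝ a ⊆ Set.Ici 0) : IsUnit (invSqrtOneAdd a) := by
  have h := invSqrtOneAdd_mul_self_mul ha ha'
  have hc : Commute (1 + a) (invSqrtOneAdd a) :=
    commute_invSqrtOneAdd ((Commute.one_left a).add_left (Commute.refl a))
  refine ⟨⟨invSqrtOneAdd a, invSqrtOneAdd a * (1 + a), by rw [← mul_assoc, h], ?_⟩, rfl⟩
  rw [mul_assoc, hc.eq, ← mul_assoc, h]

/-- Intertwining the elements `(1 + a)⁻¹` and `(1 + b)⁻¹` amounts to intertwining `a` and `b`. -/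
theorem SemiconjBy.of_invSqrtOneAdd_mul_self {x a b : A}
    (h : SemiconjBy x (1 - _root_.invSqrtOneAdd a * _root_.invSqrtOneAdd a)
      (1 - _root_.invSqrtOneAdd b * _root_.invSqrtOneAdd b))
    (ha : IsSelfAdjoint a) (hb : IsSelfAdjoint b)
    (ha' : spectrum ℝ a ⊆ Set.Ici 0) (hb' : spectrum ℝ b ⊆ Set.Ici 0) : SemiconjBy x a b := by
  have hwa := invSqrtOneAdd_mul_self_mul ha ha'
  have hwb := invSqrtOneAdd_mul_self_mul hb hb'
  have hcb : (1 + b) * (_root_.invSqrtOneAdd b * _root_.invSqrtOneAdd b) = 1 := by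
    have hc : Commute (1 + b) (_root_.invSqrtOneAdd b) :=
      commute_invSqrtOneAdd ((Commute.one_left b).add_left (Commute.refl b))
    rw [(hc.mul_right hc).eq, hwb]
  have h' : x * (_root_.invSqrtOneAdd a * _root_.invSqrtOneAdd a) =
      _root_.invSqrtOneAdd b * _root_.invSqrtOneAdd b * x := by
    have := h.eq
    rw [mul_sub, sub_mul, mul_one, one_mul] at this
    exact sub_right_injective this
  have key : x * (1 + a) = (1 + b) * x := by
    calc x * (1 + a)
        = (1 + b) * (_root_.invSqrtOneAdd b * _root_.invSqrtOneAdd b * x) * (1 + a) := by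
          rw [← mul_assoc (1 + b), hcb, one_mul]
      _ = (1 + b) * x := by
          rw [← h', mul_assoc, mul_assoc, hwa, mul_one]
  rw [mul_add, add_mul, mul_one, one_mul] at key
  exact add_left_cancel key

theorem zTransform_eq (t : ℝ) (a : A) :
    zTransform t a = t • (a * invSqrtOneAdd (t ^ 2 • (star a * a))) := by
  have hc : ContinuousOn (fun x : ℝ => (Real.sqrt (1 + x))⁻¹)
      ((t ^ 2 • ·) '' spectrum ℝ (star a * a)) := by
    refine continuousOn_inv_sqrt_one_add.mono ?_
    rintro _ ⟨x, hx, rfl⟩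
    exact mul_nonneg (sq_nonneg t) (spectrum_star_mul_self_nonneg x hx)
  rw [zTransform, invSqrtOneAdd, ← cfc_comp_smul (t ^ 2) _ (star a * a) hc]
  simp only [smul_eq_mul]

theorem commute_smul_star_mul_self {a : A} (ha : IsStarNormal a) (t : ℝ) :
    Commute a (t ^ 2 • (star a * a)) :=
  (ha.star_comm_self.symm.mul_right (Commute.refl a)).smul_right _

theorem star_zTransform {a : A} (ha : IsStarNormal a) (t : ℝ) :
    star (zTransform t a) = zTransform t (star a) := by
  have h := (commute_invSqrtOneAdd (commute_smul_star_mul_self ha t)).star_star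
  rw [(isSelfAdjoint_invSqrtOneAdd _).star_eq] at h
  rw [zTransform_eq, zTransform_eq, star_star, ← ha.star_comm_self.eq, star_smul, star_mul,
    (isSelfAdjoint_invSqrtOneAdd _).star_eq, h.eq, star_trivial]

theorem star_zTransform_mul_self {a : A} (ha : IsStarNormal a) (t : ℝ) :
    star (zTransform t a) * zTransform t a =
      1 - invSqrtOneAdd (t ^ 2 • (star a * a)) * invSqrtOneAdd (t ^ 2 • (star a * a)) := by
  have h := (commute_invSqrtOneAdd (commute_smul_star_mul_self ha t))
  have h1 := invSqrtOneAdd_mul_self_mul (isSelfAdjoint_smul_star_mul_self t a)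
    (spectrum_smul_star_mul_self_subset t a)
  have hw := (isSelfAdjoint_invSqrtOneAdd (t ^ 2 • (star a * a))).star_eq
  have hs := h.star_star
  rw [hw] at hs
  rw [zTransform_eq, star_smul, star_mul, hw, star_trivial, eq_sub_iff_add_eq, ← h1, mul_add,
    mul_one, add_comm]
  congr 1
  rw [smul_mul_smul_comm, ← sq, mul_smul_comm, h.eq]
  simp only [mul_assoc]
  rw [← mul_assoc (star a), hs.eq, mul_assoc]

end

/-- A pair `(R, S)` of normal elements is `(p², q²)`-commuting if
`z(R) z(S*) = z_{pq}(S*) z_{q/p}(R)` and `z_{q/p}(R) z(S) = z_{pq}(S) z(R)`. -/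
theorem rieffel_pq_commuting_product {A : Type*} [CStarAlgebra A] (p q : ℝ)
    (hp : 0 < p) (hq : 0 < q) (R S : A) (hR : IsStarNormal R) (hS : IsStarNormal S)
    (h1 : zTransform 1 R * zTransform 1 (star S) =
      zTransform (p * q) (star S) * zTransform (q / p) R)
    (h2 : zTransform (q / p) R * zTransform 1 S = zTransform (p * q) S * zTransform 1 R) :
    R * S = (p ^ 2 : ℝ) • (S * R) ∧ R * star S = (q ^ 2 : ℝ) • (star S * R) := by
  have wM := isSelfAdjoint_smul_star_mul_self 1 R
  have wMt := isSelfAdjoint_smul_star_mul_self (q / p) R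
  have wN := isSelfAdjoint_smul_star_mul_self 1 S
  have wNs := isSelfAdjoint_smul_star_mul_self (p * q) S
  have pM := spectrum_smul_star_mul_self_subset 1 R
  have pMt := spectrum_smul_star_mul_self_subset (q / p) R
  have pN := spectrum_smul_star_mul_self_subset 1 S
  have pNs := spectrum_smul_star_mul_self_subset (p * q) S
  have eR := star_zTransform_mul_self hR 1
  have eRt := star_zTransform_mul_self hR (q / p)
  have eS := star_zTransform_mul_self hS 1
  have eSs := star_zTransform_mul_self hS (p * q)
  have zR := zTransform_eq 1 R
  have zRt := zTransform_eq (q / p) R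
  have zS := zTransform_eq 1 S
  have zSs := zTransform_eq (p * q) S
  rw [← star_zTransform hS, ← star_zTransform hS] at h1
  have hBM : SemiconjBy (star (zTransform 1 S)) ((q / p) ^ 2 • (star R * R))
      ((1 : ℝ) ^ 2 • (star R * R)) := by
    refine SemiconjBy.of_invSqrtOneAdd_mul_self ?_ wMt wM pMt pM
    rw [← eR, ← eRt]
    have h2s := congrArg star h2
    simp only [star_mul] at h2s
    rw [SemiconjBy, ← mul_assoc, h2s, mul_assoc, mul_assoc, h1]
  have hAN : SemiconjBy (zTransform 1 R) ((1 : ℝ) ^ 2 • (star S * S))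
      ((p * q) ^ 2 • (star S * S)) := by
    refine SemiconjBy.of_invSqrtOneAdd_mul_self ?_ wN wNs pN pNs
    rw [← eS, ← eSs, SemiconjBy, ← mul_assoc, h1, mul_assoc, mul_assoc, h2]
  have hBM' : SemiconjBy (zTransform 1 S) ((1 : ℝ) ^ 2 • (star R * R))
      ((q / p) ^ 2 • (star R * R)) := hBM.of_star_left wMt wM
  have hMN : Commute ((1 : ℝ) ^ 2 • (star R * R)) ((1 : ℝ) ^ 2 • (star S * S)) := by
    refine SemiconjBy.of_invSqrtOneAdd_mul_self ?_ wN wN pN pN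
    rw [← eS]
    exact (hBM.mul_left hBM').symm
  generalize (1 : ℝ) ^ 2 • (star R * R) = M at *
  generalize (q / p) ^ 2 • (star R * R) = Mt at *
  generalize (1 : ℝ) ^ 2 • (star S * S) = N at *
  generalize (p * q) ^ 2 • (star S * S) = Ns at *
  have cuv : Commute (invSqrtOneAdd M) (invSqrtOneAdd N) :=
    commute_invSqrtOneAdd (commute_invSqrtOneAdd hMN.symm).symm
  have cuN : Commute (invSqrtOneAdd M) N := (commute_invSqrtOneAdd hMN.symm).symm
  have cvM : Commute (invSqrtOneAdd N) M := (commute_invSqrtOneAdd hMN).symm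
  have iu := isUnit_invSqrtOneAdd wM pM
  have iut := isUnit_invSqrtOneAdd wMt pMt
  have iv := isUnit_invSqrtOneAdd wN pN
  have ivs := isUnit_invSqrtOneAdd wNs pNs
  have ku := isSelfAdjoint_invSqrtOneAdd N
  have kus := isSelfAdjoint_invSqrtOneAdd Ns
  rw [one_smul] at zR zS
  have hSM : SemiconjBy (star S) Mt M := by
    rw [zS, star_mul, ku.star_eq] at hBM
    refine iv.mul_left_cancel ?_
    rw [← mul_assoc, hBM.eq, ← mul_assoc, ← mul_assoc, cvM.eq]
  have hRN : SemiconjBy R N Ns := by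
    rw [zR] at hAN
    refine iu.mul_right_cancel ?_
    rw [mul_assoc, ← cuN.eq, ← mul_assoc, hAN.eq, mul_assoc]
  have hSM' : SemiconjBy S M Mt := hSM.of_star_left wMt wM
  have hSu := hSM.invSqrtOneAdd wMt wM pMt pM
  have hSu' := hSM'.invSqrtOneAdd wM wMt pM pMt
  have hRv := hRN.invSqrtOneAdd wN wNs pN pNs
  rw [zR, zS, zRt, zSs] at h1 h2
  rw [star_smul, star_trivial (p * q), star_mul, star_mul, ku.star_eq, kus.star_eq] at h1
  generalize invSqrtOneAdd M = u at *
  generalize invSqrtOneAdd Mt = ut at *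
  generalize invSqrtOneAdd N = v at *
  generalize invSqrtOneAdd Ns = vs at *
  constructor
  · have key : (q / p) • (R * S * (u * v)) = (p * q) • (S * R * (u * v)) := by
      calc (q / p) • (R * S * (u * v)) = (q / p) • (R * ut) * (S * v) := by
            rw [smul_mul_assoc, mul_assoc, mul_assoc, ← mul_assoc S, hSu'.eq, mul_assoc]
        _ = (p * q) • (S * R * (u * v)) := by
            rw [h2, smul_mul_assoc, mul_assoc, mul_assoc, ← mul_assoc vs, ← hRv.eq, cuv.eq,
              mul_assoc]
    rw [← smul_mul_assoc (q / p), ← smul_mul_assoc (p * q)] at key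
    have := congrArg (fun x => (p / q) • x) ((iu.mul iv).mul_right_cancel key)
    simp only [smul_smul] at this
    rwa [div_mul_div_cancel₀ hq.ne', div_self hp.ne', one_smul,
      show p / q * (p * q) = p ^ 2 by field_simp] at this
  · have key : vs * (R * star S) * ut = vs * (q ^ 2 • (star S * R)) * ut := by
      calc vs * (R * star S) * ut = R * u * (v * star S) := by
            rw [← mul_assoc, ← hRv.eq, mul_assoc, hSu.eq, mul_assoc, ← mul_assoc v, ← cuv.eq]
            simp only [mul_assoc]
        _ = vs * (q ^ 2 • (star S * R)) * ut := by
            rw [h1, smul_mul_smul_comm, show p * q * (q / p) = q ^ 2 by field_simp]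
            simp only [mul_smul_comm, smul_mul_assoc, mul_assoc]
    exact ivs.mul_left_cancel (iut.mul_right_cancel key)
end

section
/- The map which sends z₁ ∈ ℂ to the continuous character z₂ ↦ exp(i·Im(z₁·z₂)) of the additive group (ℂ, +) is an isomorphism of topological groups from (ℂ, +) onto its Pontryagin dual; in other words, the bicharacter (z₁, z₂) ↦ exp(i·Im(z₁·z₂)) establishes a self-duality of the locally compact abelian group (ℂ, +). -/
/-- Two continuous real-valued functions on a connected space that agree at a point and have
the same image under `Circle.exp` are equal. -/
theorem Circle.eq_of_exp_eq {A : Type*} [TopologicalSpace A] [PreconnectedSpace A] {f g : A → ℝ}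
    (hf : Continuous f) (hg : Continuous g) (h : ∀ a, Circle.exp (f a) = Circle.exp (g a))
    (a : A) (ha : f a = g a) : f = g :=
  Circle.isCoveringMap_exp.eq_of_comp_eq hf hg (funext h) a ha

/-- Every continuous unitary character of a real topological vector space that is simply and
locally path connected is the exponential of a continuous linear functional. -/
theorem PontryaginDual.exists_continuousLinearMap_exp_eq {E : Type*} [AddCommGroup E] [Module ℝ E]
    [TopologicalSpace E] [IsTopologicalAddGroup E] [ContinuousSMul ℝ E]
    [SimplyConnectedSpace E] [LocallyPathConnectedSpace E]
    (χ : PontryaginDual (Multiplicative E)) :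
    ∃ f : E →L[ℝ] ℝ, ∀ w, Circle.exp (f w) = χ (Multiplicative.ofAdd w) := by
  obtain ⟨F, ⟨hF0, hF⟩, -⟩ := Circle.isCoveringMap_exp.existsUnique_continuousMap_lifts
    (⟨fun w : E ↦ χ (Multiplicative.ofAdd w), (map_continuous χ).comp continuous_ofAdd⟩)
    (0 : E) 0 (by simp)
  have hexp (w : E) : Circle.exp (F w) = χ (Multiplicative.ofAdd w) := congrFun hF w
  have hadd : (fun p : E × E ↦ F (p.1 + p.2)) = fun p ↦ F p.1 + F p.2 :=
    Circle.eq_of_exp_eq (by fun_prop) (by fun_prop)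
      (fun p ↦ by simp [Circle.exp_add, hexp, ofAdd_add]) (0, 0) (by simp [hF0])
  exact ⟨(AddMonoidHom.mk' F fun x y ↦ congrFun hadd (x, y)).toRealLinearMap F.continuous, hexp⟩

/-- The character `w ↦ exp(i·Im(z·w))` of `(ℂ, +)`, as a homomorphism in `z`. -/
noncomputable def Complex.imMulDual : Multiplicative ℂ →* PontryaginDual (Multiplicative ℂ) where
  toFun z := (
    { toFun := fun w ↦ Circle.exp (z.toAdd * w.toAdd).im
      map_one' := by simp
      map_mul' := fun v w ↦ by simp only [toAdd_mul, mul_add, Complex.add_im, Circle.exp_add]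
      continuous_toFun := Circle.exp.continuous.comp <| Complex.continuous_im.comp <|
        continuous_const.mul continuous_toAdd } : Multiplicative ℂ →ₜ* Circle)
  map_one' := PontryaginDual.ext fun w ↦ show Circle.exp _ = 1 by simp
  map_mul' v w := PontryaginDual.ext fun u ↦ show Circle.exp _ = Circle.exp _ * Circle.exp _ by
    simp only [toAdd_mul, add_mul, Complex.add_im, Circle.exp_add]

namespace Complex

theorem imMulDual_apply (z w : Multiplicative ℂ) :
    imMulDual z w = Circle.exp (z.toAdd * w.toAdd).im :=
  rfl

theorem continuous_imMulDual : Continuous imMulDual :=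
  ContinuousMonoidHom.continuous_of_continuous_uncurry (B := Multiplicative ℂ) (C := Circle) _ <|
    Circle.exp.continuous.comp <| Complex.continuous_im.comp <|
      (continuous_toAdd.comp continuous_fst).mul (continuous_toAdd.comp continuous_snd)

theorem imMulDual_injective : Function.Injective imMulDual := by
  refine (injective_iff_map_eq_one _).2 fun z hz ↦ ?_
  have h : (fun w : ℂ ↦ (z.toAdd * w).im) = fun _ ↦ 0 :=
    Circle.eq_of_exp_eq (by fun_prop) continuous_const
      (fun w ↦ by simpa [imMulDual_apply] using DFunLike.congr_fun hz (Multiplicative.ofAdd w))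
      0 (by simp)
  exact Multiplicative.toAdd.injective <|
    Complex.ext (by simpa using congrFun h I) (by simpa using congrFun h 1)

theorem imMulDual_surjective : Function.Surjective imMulDual := by
  intro χ
  obtain ⟨f, hf⟩ := PontryaginDual.exists_continuousLinearMap_exp_eq χ
  refine ⟨Multiplicative.ofAdd ⟨f I, f 1⟩, PontryaginDual.ext fun w ↦ ?_⟩
  have hw : f w.toAdd = w.toAdd.re * f 1 + w.toAdd.im * f I := by
    conv_lhs => rw [show w.toAdd = w.toAdd.re • (1 : ℂ) + w.toAdd.im • I by simp [re_add_im]]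
    rw [map_add, map_smul, map_smul, smul_eq_mul, smul_eq_mul]
  rw [imMulDual_apply, ← ofAdd_toAdd w, ← hf, toAdd_ofAdd, toAdd_ofAdd, hw, mul_im]
  congr 1
  ring

theorem isOpenMap_imMulDual : IsOpenMap imMulDual :=
  haveI : SigmaCompactSpace (Multiplicative ℂ) := inferInstanceAs (SigmaCompactSpace ℂ)
  imMulDual.isOpenMap_of_sigmaCompact imMulDual_surjective continuous_imMulDual

end Complex

/-- The bicharacter `(z₁, z₂) ↦ exp(i·Im(z₁·z₂))` establishes a self-duality of the locally
compact abelian group `(ℂ, +)`: the map sending `z₁` to the character `z₂ ↦ exp(i·Im(z₁·z₂))`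
is an isomorphism of topological groups from `(ℂ, +)` onto its Pontryagin dual. -/
theorem complex_self_duality :
    ∃ e : ℂ ≃ PontryaginDual (Multiplicative ℂ),
      (∀ z w : ℂ, ((e z (Multiplicative.ofAdd w) : Circle) : ℂ) =
        Complex.exp (Complex.I * (((z * w).im : ℝ) : ℂ))) ∧
      (∀ z w : ℂ, e (z + w) = e z * e w) ∧
      Continuous e ∧ Continuous e.symm := by
  let e := Multiplicative.ofAdd.trans
    (Equiv.ofBijective _ ⟨Complex.imMulDual_injective, Complex.imMulDual_surjective⟩)
  have he : Continuous e := Complex.continuous_imMulDual.comp continuous_ofAdd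
  have ho : IsOpenMap e := Complex.isOpenMap_imMulDual
  refine ⟨e, fun z w ↦ ?_, fun z w ↦ map_mul Complex.imMulDual _ _, he,
    (e.toHomeomorphOfContinuousOpen he ho).symm.continuous⟩
  change ((Circle.exp (z * w).im : Circle) : ℂ) = _
  rw [Circle.coe_exp, mul_comm]
end
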